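/- Let n ≥ 4, m ≥ 1 and set ℓ = (n−1)m+1. Let C_1,…,C_{n−1} be symmetric n×n (0,1)-matrices satisfying ∑_{i=1}^{n−1} C_i = (n/2)·I_n + ((n−2)/2)·J_n, C_i·C_iᵀ = (n/2)·C_i for every i, and C_i·C_jᵀ = (n/4)·J_n for all distinct i,j. Let W_1,…,W_{n−1} be ℓ×ℓ matrices with entries in {0,1,−1} such that W_i·W_iᵀ = m·I_ℓ for every i and ∑_{i=1}^{n−1} |W_i| = J_ℓ − I_ℓ, where |W_i| is the entrywise absolute value. Write W_i = W_{i,1} − W_{i,2}, where W_{i,1} and W_{i,2} are the (0,1)-matrices recording the entries +1 and −1 of W_i respectively. Define A⁺ = ∑_{i=1}^{n−1} (W_{i,1} ⊗ C_i + W_{i,2} ⊗ (J_n − C_i)) and A⁻ = ∑_{i=1}^{n−1} (W_{i,1} ⊗ (J_n − C_i) + W_{i,2} ⊗ C_i). Then A⁺ and A⁻ are (0,1)-matrices with A⁺ + A⁻ + (I_ℓ ⊗ J_n) = J_{ℓn}; each of A⁺ and A⁻ satisfies X·Xᵀ = Xᵀ·X = (n²m/4)·(I_ℓ⊗I_n)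 + (n(1−m)/4)·(I_ℓ⊗J_n) + (n((n−1)m−1)/4)·J_{ℓn}, so that A⁺ and A⁻ are twin SGDDs with parameters (nℓ, n(n−1)m/2, ℓ, n, n(n−2)m/4, n((n−1)m−1)/4); and A⁺·(I_ℓ⊗J_n) = (I_ℓ⊗J_n)·A⁺ = A⁻·(I_ℓ⊗J_n) = (I_ℓ⊗J_n)·A⁻ = (n/2)·(J_{ℓn} − I_ℓ⊗J_n). -/

import Mathlib

open Matrix Kronecker

/-- The all-ones matrix. -/
def matJ (α : Type*) : Matrix α α ℝ := Matrix.of fun _ _ => 1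

/-- The block-diagonal matrix `K_{m,n} = I_m ⊗ J_n`. -/
def matK (m n : ℕ) : Matrix (Fin m × Fin n) (Fin m × Fin n) ℝ :=
  Matrix.of fun p q => if p.1 = q.1 then 1 else 0

/-- A (0,1)-matrix. -/
def Is01 {α β : Type*} (A : Matrix α β ℝ) : Prop := ∀ i j, A i j = 0 ∨ A i j = 1

attribute [local instance] Classical.propDecidable

theorem matJ_mul_self (α : Type*) [Fintype α] :
    matJ α * matJ α = (Fintype.card α : ℝ) • matJ α := by
  ext i j
  simp [matJ, Matrix.mul_apply]

theorem matJ_tr (α : Type*) : (matJ α)ᵀ = matJ α := by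
  ext i j
  simp [matJ]

theorem core_lemma {L N I : Type*} [Fintype L] [Fintype N] [Fintype I] [DecidableEq L]
    [DecidableEq N] [DecidableEq I] (n m : ℝ)
    (hN : (Fintype.card N : ℝ) = n) (hL : (Fintype.card L : ℝ) = (n - 1) * m + 1)
    (H : I → Matrix N N ℝ) (W : I → Matrix L L ℝ)
    (hHs : ∀ i, (H i)ᵀ = H i) (hHJ : ∀ i, H i * matJ N = 0) (hJH : ∀ i, matJ N * H i = 0)
    (hHij : ∀ i j, i ≠ j → H i * H j = 0) (hHii : ∀ i, H i * H i = n • H i)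
    (hsum : ∑ i, H i = n • (1 : Matrix N N ℝ) - matJ N)
    (hW : ∀ i, W i * (W i)ᵀ = m • (1 : Matrix L L ℝ))
    (hW' : ∀ i, (W i)ᵀ * W i = m • (1 : Matrix L L ℝ))
    (e : ℝ) (he : e * e = 1) (A : Matrix (L × N) (L × N) ℝ)
    (hA : A = (1 / 2 : ℝ) • ((matJ L - 1) ⊗ₖ matJ N + e • ∑ i, W i ⊗ₖ H i)) :
    A * Aᵀ = (n ^ 2 * m / 4) • ((1 : Matrix L L ℝ) ⊗ₖ (1 : Matrix N N ℝ))
      + (n * (1 - m) / 4) • ((1 : Matrix L L ℝ) ⊗ₖ matJ N)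
      + (n * ((n - 1) * m - 1) / 4) • (matJ L ⊗ₖ matJ N) ∧
    Aᵀ * A = (n ^ 2 * m / 4) • ((1 : Matrix L L ℝ) ⊗ₖ (1 : Matrix N N ℝ))
      + (n * (1 - m) / 4) • ((1 : Matrix L L ℝ) ⊗ₖ matJ N)
      + (n * ((n - 1) * m - 1) / 4) • (matJ L ⊗ₖ matJ N) ∧
    A * ((1 : Matrix L L ℝ) ⊗ₖ matJ N)
      = (n / 2) • (matJ L ⊗ₖ matJ N - (1 : Matrix L L ℝ) ⊗ₖ matJ N) ∧
    ((1 : Matrix L L ℝ) ⊗ₖ matJ N) * A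
      = (n / 2) • (matJ L ⊗ₖ matJ N - (1 : Matrix L L ℝ) ⊗ₖ matJ N) := by
  set S := ∑ i, W i ⊗ₖ H i with hS
  have hSX : ∀ X : Matrix L L ℝ, S * (X ⊗ₖ matJ N) = 0 := by
    intro X
    rw [hS, Finset.sum_mul]
    refine Finset.sum_eq_zero fun i _ => ?_
    rw [← Matrix.mul_kronecker_mul, hHJ, Matrix.kronecker_zero]
  have hXS : ∀ X : Matrix L L ℝ, (X ⊗ₖ matJ N) * S = 0 := by
    intro X
    rw [hS, Finset.mul_sum]
    refine Finset.sum_eq_zero fun i _ => ?_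
    rw [← Matrix.mul_kronecker_mul, hJH, Matrix.kronecker_zero]
  have hSt : Sᵀ = ∑ i, (W i)ᵀ ⊗ₖ H i := by
    rw [hS, Matrix.transpose_sum]
    refine Finset.sum_congr rfl fun i _ => ?_
    rw [← Matrix.kroneckerMap_transpose, hHs]
  have hStX : ∀ X : Matrix L L ℝ, Sᵀ * (X ⊗ₖ matJ N) = 0 := by
    intro X
    have := congrArg Matrix.transpose (hXS Xᵀ)
    rw [Matrix.transpose_mul, ← Matrix.kroneckerMap_transpose, matJ_tr] at this
    simpa using this
  have hXSt : ∀ X : Matrix L L ℝ, (X ⊗ₖ matJ N) * Sᵀ = 0 := by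
    intro X
    have := congrArg Matrix.transpose (hSX Xᵀ)
    rw [Matrix.transpose_mul, ← Matrix.kroneckerMap_transpose, matJ_tr] at this
    simpa using this
  have hfin : ∑ i, (m • (1 : Matrix L L ℝ)) ⊗ₖ (n • H i)
      = (m * n) • (n • ((1 : Matrix L L ℝ) ⊗ₖ (1 : Matrix N N ℝ))
        - (1 : Matrix L L ℝ) ⊗ₖ matJ N) := by
    have h1 : (1 : Matrix L L ℝ) ⊗ₖ (∑ i, H i) = ∑ i, (1 : Matrix L L ℝ) ⊗ₖ H i := by
      ext p q
      simp [Matrix.kroneckerMap_apply, Matrix.sum_apply, Finset.mul_sum]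
    have h2 : n • ((1 : Matrix L L ℝ) ⊗ₖ (1 : Matrix N N ℝ)) - (1 : Matrix L L ℝ) ⊗ₖ matJ N
      = (1 : Matrix L L ℝ) ⊗ₖ (∑ i, H i) := by
      rw [hsum]
      ext p q
      simp only [Matrix.kroneckerMap_apply, Matrix.sub_apply, Matrix.smul_apply, smul_eq_mul]
      ring
    rw [h2, h1, Finset.smul_sum]
    refine Finset.sum_congr rfl fun i _ => ?_
    rw [Matrix.smul_kronecker, Matrix.kronecker_smul, smul_smul]
  have hSS : S * Sᵀ = (m * n) • (n • ((1 : Matrix L L ℝ) ⊗ₖ (1 : Matrix N N ℝ))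
        - (1 : Matrix L L ℝ) ⊗ₖ matJ N) := by
    rw [← hfin, hSt, hS, Finset.sum_mul]
    refine Finset.sum_congr rfl fun i _ => ?_
    rw [Finset.mul_sum, Finset.sum_eq_single i]
    · rw [← Matrix.mul_kronecker_mul, hW, hHii]
    · intro j _ hj
      rw [← Matrix.mul_kronecker_mul, hHij i j hj.symm, Matrix.kronecker_zero]
    · simp
  have hSS' : Sᵀ * S = (m * n) • (n • ((1 : Matrix L L ℝ) ⊗ₖ (1 : Matrix N N ℝ))
        - (1 : Matrix L L ℝ) ⊗ₖ matJ N) := by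
    rw [← hfin, hSt, hS, Finset.sum_mul]
    refine Finset.sum_congr rfl fun i _ => ?_
    rw [Finset.mul_sum, Finset.sum_eq_single i]
    · rw [← Matrix.mul_kronecker_mul, hW', hHii]
    · intro j _ hj
      rw [← Matrix.mul_kronecker_mul, hHij i j hj.symm, Matrix.kronecker_zero]
    · simp
  have hJ1 : (matJ L - 1) * (matJ L - 1) = ((n - 1) * m - 1) • matJ L + 1 := by
    rw [sub_mul, mul_sub, matJ_mul_self, hL]
    simp only [mul_one, one_mul]
    module
  have hE : ((matJ L - 1) ⊗ₖ matJ N) * ((matJ L - 1) ⊗ₖ matJ N)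
      = (n * ((n - 1) * m - 1)) • (matJ L ⊗ₖ matJ N) + n • ((1 : Matrix L L ℝ) ⊗ₖ matJ N) := by
    rw [← Matrix.mul_kronecker_mul, hJ1, matJ_mul_self, hN, Matrix.add_kronecker,
      Matrix.smul_kronecker, Matrix.kronecker_smul, Matrix.kronecker_smul]
    module
  have hEt : ((matJ L - 1) ⊗ₖ matJ N)ᵀ = (matJ L - 1) ⊗ₖ matJ N := by
    rw [← Matrix.kroneckerMap_transpose, matJ_tr, Matrix.transpose_sub, matJ_tr,
      Matrix.transpose_one]
  have hEK : (matJ L - 1) ⊗ₖ matJ N = matJ L ⊗ₖ matJ N - (1 : Matrix L L ℝ) ⊗ₖ matJ N := by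
    ext p q
    simp only [Matrix.kroneckerMap_apply, Matrix.sub_apply]
    ring
  have hAt : Aᵀ = (1 / 2 : ℝ) • ((matJ L - 1) ⊗ₖ matJ N + e • Sᵀ) := by
    rw [hA, Matrix.transpose_smul, Matrix.transpose_add, hEt, Matrix.transpose_smul]
  refine ⟨?_, ?_, ?_, ?_⟩
  · rw [hAt, hA]
    simp only [smul_mul_assoc, mul_smul_comm, add_mul, mul_add, hE, hSX, hXSt, hSS]
    rcases mul_self_eq_one_iff.mp he with h | h <;> rw [h] <;> module
  · rw [hAt, hA]
    simp only [smul_mul_assoc, mul_smul_comm, add_mul, mul_add, hE, hStX, hXS, hSS']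
    rcases mul_self_eq_one_iff.mp he with h | h <;> rw [h] <;> module
  · rw [hA, smul_mul_assoc, add_mul, smul_mul_assoc, hSX, ← Matrix.mul_kronecker_mul,
      matJ_mul_self, hN, mul_one, Matrix.kronecker_smul, hEK]
    module
  · rw [hA, mul_smul_comm, mul_add, mul_smul_comm, hXS, ← Matrix.mul_kronecker_mul,
      matJ_mul_self, hN, one_mul, Matrix.kronecker_smul, hEK]
    module

theorem matK_eq (l n : ℕ) : matK l n = (1 : Matrix (Fin l) (Fin l) ℝ) ⊗ₖ matJ (Fin n) := by
  ext p q
  simp [matK, matJ, Matrix.kroneckerMap_apply, Matrix.one_apply]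

theorem matJ_prod (α β : Type*) : matJ (α × β) = matJ α ⊗ₖ matJ β := by
  ext p q
  simp [matJ, Matrix.kroneckerMap_apply]

theorem isNat_sum {I : Type*} [Fintype I] (f : I → ℝ) (hf : ∀ i, ∃ k : ℕ, f i = k) :
    ∃ k : ℕ, ∑ i, f i = k := by
  choose g hg using hf
  exact ⟨∑ i, g i, by push_cast; exact Finset.sum_congr rfl fun i _ => hg i⟩

theorem stmt16 (n m : ℕ) (hn : 4 ≤ n) (hm : 1 ≤ m)
    (C : Fin (n - 1) → Matrix (Fin n) (Fin n) ℝ)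
    (hCsym : ∀ i, (C i)ᵀ = C i) (hC01 : ∀ i, Is01 (C i))
    (hCsum : ∑ i, C i = ((n : ℝ) / 2) • (1 : Matrix (Fin n) (Fin n) ℝ)
      + (((n : ℝ) - 2) / 2) • matJ (Fin n))
    (hCsq : ∀ i, C i * (C i)ᵀ = ((n : ℝ) / 2) • C i)
    (hCij : ∀ i j, i ≠ j → C i * (C j)ᵀ = ((n : ℝ) / 4) • matJ (Fin n))
    (W : Fin (n - 1) → Matrix (Fin ((n - 1) * m + 1)) (Fin ((n - 1) * m + 1)) ℝ)
    (hWent : ∀ i p q, W i p q = 0 ∨ W i p q = 1 ∨ W i p q = -1)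
    (hWw : ∀ i, W i * (W i)ᵀ
      = (m : ℝ) • (1 : Matrix (Fin ((n - 1) * m + 1)) (Fin ((n - 1) * m + 1)) ℝ))
    (hWsum : ∑ i, Matrix.of (fun p q => |W i p q|)
      = matJ (Fin ((n - 1) * m + 1)) - 1)
    (W1 W2 : Fin (n - 1) → Matrix (Fin ((n - 1) * m + 1)) (Fin ((n - 1) * m + 1)) ℝ)
    (hW1 : ∀ i, W1 i = Matrix.of fun p q => if W i p q = 1 then 1 else 0)
    (hW2 : ∀ i, W2 i = Matrix.of fun p q => if W i p q = -1 then 1 else 0)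
    (Ap Am : Matrix (Fin ((n - 1) * m + 1) × Fin n) (Fin ((n - 1) * m + 1) × Fin n) ℝ)
    (hAp : Ap = ∑ i, (W1 i ⊗ₖ C i + W2 i ⊗ₖ (matJ (Fin n) - C i)))
    (hAm : Am = ∑ i, (W1 i ⊗ₖ (matJ (Fin n) - C i) + W2 i ⊗ₖ C i)) :
    Is01 Ap ∧ Is01 Am ∧
    Ap + Am + matK ((n - 1) * m + 1) n
      = matJ (Fin ((n - 1) * m + 1) × Fin n) ∧
    Ap * Apᵀ = ((n : ℝ) ^ 2 * m / 4) •
        (1 : Matrix (Fin ((n - 1) * m + 1) × Fin n) (Fin ((n - 1) * m + 1) × Fin n) ℝ)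
      + ((n : ℝ) * (1 - (m : ℝ)) / 4) • matK ((n - 1) * m + 1) n
      + ((n : ℝ) * (((n : ℝ) - 1) * m - 1) / 4) • matJ (Fin ((n - 1) * m + 1) × Fin n) ∧
    Apᵀ * Ap = ((n : ℝ) ^ 2 * m / 4) •
        (1 : Matrix (Fin ((n - 1) * m + 1) × Fin n) (Fin ((n - 1) * m + 1) × Fin n) ℝ)
      + ((n : ℝ) * (1 - (m : ℝ)) / 4) • matK ((n - 1) * m + 1) n
      + ((n : ℝ) * (((n : ℝ) - 1) * m - 1) / 4) • matJ (Fin ((n - 1) * m + 1) × Fin n) ∧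
    Am * Amᵀ = ((n : ℝ) ^ 2 * m / 4) •
        (1 : Matrix (Fin ((n - 1) * m + 1) × Fin n) (Fin ((n - 1) * m + 1) × Fin n) ℝ)
      + ((n : ℝ) * (1 - (m : ℝ)) / 4) • matK ((n - 1) * m + 1) n
      + ((n : ℝ) * (((n : ℝ) - 1) * m - 1) / 4) • matJ (Fin ((n - 1) * m + 1) × Fin n) ∧
    Amᵀ * Am = ((n : ℝ) ^ 2 * m / 4) •
        (1 : Matrix (Fin ((n - 1) * m + 1) × Fin n) (Fin ((n - 1) * m + 1) × Fin n) ℝ)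
      + ((n : ℝ) * (1 - (m : ℝ)) / 4) • matK ((n - 1) * m + 1) n
      + ((n : ℝ) * (((n : ℝ) - 1) * m - 1) / 4) • matJ (Fin ((n - 1) * m + 1) × Fin n) ∧
    Ap * matK ((n - 1) * m + 1) n = ((n : ℝ) / 2) •
      (matJ (Fin ((n - 1) * m + 1) × Fin n) - matK ((n - 1) * m + 1) n) ∧
    matK ((n - 1) * m + 1) n * Ap = ((n : ℝ) / 2) •
      (matJ (Fin ((n - 1) * m + 1) × Fin n) - matK ((n - 1) * m + 1) n) ∧
    Am * matK ((n - 1) * m + 1) n = ((n : ℝ) / 2) •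
      (matJ (Fin ((n - 1) * m + 1) × Fin n) - matK ((n - 1) * m + 1) n) ∧
    matK ((n - 1) * m + 1) n * Am = ((n : ℝ) / 2) •
      (matJ (Fin ((n - 1) * m + 1) × Fin n) - matK ((n - 1) * m + 1) n) := by
  have hn4 : (4 : ℝ) ≤ n := by exact_mod_cast hn
  have hm1 : (1 : ℝ) ≤ m := by exact_mod_cast hm
  have hCC : ∀ i, C i * C i = ((n : ℝ) / 2) • C i := fun i => by
    have := hCsq i
    rwa [hCsym] at this
  have hCC' : ∀ i j, i ≠ j → C i * C j = ((n : ℝ) / 4) • matJ (Fin n) := fun i j h => by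
    have := hCij i j h
    rwa [hCsym] at this
  have hcn : ((n - 1 : ℕ) : ℝ) = n - 1 := by
    rw [Nat.cast_sub (by omega)]; simp
  have hCJ : ∀ i, C i * matJ (Fin n) = ((n : ℝ) / 2) • matJ (Fin n) := by
    intro i
    have h1 := congrArg (fun X => C i * X) hCsum
    simp only [Finset.mul_sum, mul_add, mul_smul_comm, mul_one] at h1
    rw [← Finset.add_sum_erase _ _ (Finset.mem_univ i), hCC,
      Finset.sum_congr rfl (fun j hj => hCC' i j (Finset.ne_of_mem_erase hj).symm),
      Finset.sum_const, Finset.card_erase_of_mem (Finset.mem_univ i), Finset.card_univ,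
      Fintype.card_fin, add_right_inj, ← Nat.cast_smul_eq_nsmul ℝ, Nat.cast_sub (by omega), hcn]
      at h1
    ext a b
    have h2 := congrFun (congrFun h1 a) b
    simp only [Matrix.smul_apply, smul_eq_mul] at h2 ⊢
    have h3 : ((n : ℝ) - 2) / 2 ≠ 0 := by
      apply ne_of_gt; linarith
    apply mul_left_cancel₀ h3
    rw [← h2]
    push_cast
    ring
  have hJC : ∀ i, matJ (Fin n) * C i = ((n : ℝ) / 2) • matJ (Fin n) := by
    intro i
    have := congrArg Matrix.transpose (hCJ i)
    rwa [Matrix.transpose_mul, Matrix.transpose_smul, matJ_tr, hCsym] at this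
  have hJJ : matJ (Fin n) * matJ (Fin n) = (n : ℝ) • matJ (Fin n) := by
    rw [matJ_mul_self, Fintype.card_fin]
  have hWt : ∀ i, (W i)ᵀ * W i
      = (m : ℝ) • (1 : Matrix (Fin ((n - 1) * m + 1)) (Fin ((n - 1) * m + 1)) ℝ) := by
    intro i
    have hm0 : (m : ℝ) ≠ 0 := by linarith
    have h1 : W i * ((m : ℝ)⁻¹ • (W i)ᵀ) = 1 := by
      rw [mul_smul_comm, hWw, smul_smul, inv_mul_cancel₀ hm0, one_smul]
    have h2 := mul_eq_one_comm.mp h1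
    rw [← h2, smul_mul_assoc, smul_smul, mul_inv_cancel₀ hm0, one_smul]
  have e1 : ∀ i p q, W1 i p q = (|W i p q| + W i p q) / 2 := by
    intro i p q
    rw [hW1]
    rcases hWent i p q with h | h | h <;> simp [h] <;> norm_num
  have e2 : ∀ i p q, W2 i p q = (|W i p q| - W i p q) / 2 := by
    intro i p q
    rw [hW2]
    rcases hWent i p q with h | h | h <;> simp [h] <;> norm_num
  have hs : ∀ p q, ∑ i, |W i p q|
      = (matJ (Fin ((n - 1) * m + 1)) - 1 : Matrix _ _ ℝ) p q := by
    intro p q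
    rw [← hWsum, Matrix.sum_apply]
    rfl
  have hJ1 : ∀ a b, matJ (Fin n) a b = 1 := fun _ _ => rfl
  have fp : Ap = (1 / 2 : ℝ) • ((matJ (Fin ((n - 1) * m + 1)) - 1) ⊗ₖ matJ (Fin n)
      + (1 : ℝ) • ∑ i, W i ⊗ₖ ((2 : ℝ) • C i - matJ (Fin n))) := by
    rw [hAp]
    ext ⟨p, a⟩ ⟨q, b⟩
    simp only [Matrix.sum_apply, Matrix.add_apply, Matrix.smul_apply, Matrix.kroneckerMap_apply,
      ← hs, e1, e2, smul_eq_mul, Matrix.sub_apply (matJ (Fin n)), Matrix.sub_apply (_ • _), hJ1]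
    rw [mul_one, one_mul, ← Finset.sum_add_distrib, Finset.mul_sum]
    refine Finset.sum_congr rfl fun i _ => ?_
    ring
  have fm : Am = (1 / 2 : ℝ) • ((matJ (Fin ((n - 1) * m + 1)) - 1) ⊗ₖ matJ (Fin n)
      + (-1 : ℝ) • ∑ i, W i ⊗ₖ ((2 : ℝ) • C i - matJ (Fin n))) := by
    rw [hAm]
    ext ⟨p, a⟩ ⟨q, b⟩
    simp only [Matrix.sum_apply, Matrix.add_apply, Matrix.smul_apply, Matrix.kroneckerMap_apply,
      ← hs, e1, e2, smul_eq_mul, Matrix.sub_apply (matJ (Fin n)), Matrix.sub_apply (_ • _), hJ1]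
    rw [mul_one, Finset.mul_sum, ← Finset.sum_add_distrib, Finset.mul_sum]
    refine Finset.sum_congr rfl fun i _ => ?_
    ring
  have hone : (1 : Matrix (Fin ((n - 1) * m + 1) × Fin n) (Fin ((n - 1) * m + 1) × Fin n) ℝ)
      = (1 : Matrix (Fin ((n - 1) * m + 1)) (Fin ((n - 1) * m + 1)) ℝ)
        ⊗ₖ (1 : Matrix (Fin n) (Fin n) ℝ) := by
    ext ⟨p, a⟩ ⟨q, b⟩
    simp only [Matrix.kroneckerMap_apply, Matrix.one_apply, Prod.mk.injEq]
    by_cases h1 : p = q <;> by_cases h2 : a = b <;> simp [h1, h2]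
  have hsumall : Ap + Am + matK ((n - 1) * m + 1) n
      = matJ (Fin ((n - 1) * m + 1) × Fin n) := by
    have hEK : (matJ (Fin ((n - 1) * m + 1)) - 1 : Matrix _ _ ℝ) ⊗ₖ matJ (Fin n)
        = matJ (Fin ((n - 1) * m + 1)) ⊗ₖ matJ (Fin n)
          - (1 : Matrix (Fin ((n - 1) * m + 1)) (Fin ((n - 1) * m + 1)) ℝ) ⊗ₖ matJ (Fin n) := by
      ext p q
      simp only [Matrix.kroneckerMap_apply, Matrix.sub_apply]
      ring
    rw [fp, fm, matK_eq, matJ_prod, hEK]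
    module
  have key := core_lemma (L := Fin ((n - 1) * m + 1)) (N := Fin n) (I := Fin (n - 1)) (n : ℝ) m
    (by simp) (by rw [Fintype.card_fin]; push_cast; rw [hcn])
    (fun i => (2 : ℝ) • C i - matJ (Fin n)) W
    (fun i => by rw [Matrix.transpose_sub, Matrix.transpose_smul, hCsym, matJ_tr])
    (fun i => by rw [sub_mul, smul_mul_assoc, hCJ, hJJ]; module)
    (fun i => by rw [mul_sub, mul_smul_comm, hJC, hJJ]; module)
    (fun i j h => by
      simp only [sub_mul, mul_sub, smul_mul_assoc, mul_smul_comm, hCJ, hJC, hJJ, hCC' i j h]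
      module)
    (fun i => by
      simp only [sub_mul, mul_sub, smul_mul_assoc, mul_smul_comm, hCJ, hJC, hJJ, hCC i]
      module)
    (by
      rw [Finset.sum_sub_distrib, ← Finset.smul_sum, hCsum, Finset.sum_const, Finset.card_univ,
        Fintype.card_fin, ← Nat.cast_smul_eq_nsmul ℝ, hcn]
      module)
    hWw hWt
  obtain ⟨p1, p2, p3, p4⟩ := key 1 (by norm_num) Ap fp
  obtain ⟨q1, q2, q3, q4⟩ := key (-1) (by norm_num) Am fm
  have c01 : ∀ (P : Prop) (x : ℝ), (x = 0 ∨ x = 1) → ∃ k : ℕ, (if P then (1:ℝ) else 0) * x = k := by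
    intro P x hx
    by_cases hP : P
    · rcases hx with h | h
      · exact ⟨0, by simp [h]⟩
      · exact ⟨1, by simp [h, hP]⟩
    · exact ⟨0, by simp [hP]⟩
  have c01' : ∀ x : ℝ, (x = 0 ∨ x = 1) → (1 - x = 0 ∨ 1 - x = 1) := by
    rintro x (h | h) <;> simp [h]
  have np : ∀ x y, ∃ k : ℕ, Ap x y = k := by
    rintro ⟨p, a⟩ ⟨q, b⟩
    rw [hAp, Matrix.sum_apply]
    refine isNat_sum _ fun i => ?_
    obtain ⟨k1, h1⟩ := c01 (W i p q = 1) _ (hC01 i a b)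
    obtain ⟨k2, h2⟩ := c01 (W i p q = -1) _ (c01' _ (hC01 i a b))
    refine ⟨k1 + k2, ?_⟩
    push_cast
    rw [← h1, ← h2, hW1, hW2]
    rfl
  have nm : ∀ x y, ∃ k : ℕ, Am x y = k := by
    rintro ⟨p, a⟩ ⟨q, b⟩
    rw [hAm, Matrix.sum_apply]
    refine isNat_sum _ fun i => ?_
    obtain ⟨k1, h1⟩ := c01 (W i p q = 1) _ (c01' _ (hC01 i a b))
    obtain ⟨k2, h2⟩ := c01 (W i p q = -1) _ (hC01 i a b)
    refine ⟨k1 + k2, ?_⟩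
    push_cast
    rw [← h1, ← h2, hW1, hW2]
    rfl
  have hle : ∀ x y, Ap x y + Am x y ≤ 1 := by
    intro x y
    have h := congrFun (congrFun hsumall x) y
    have hK : 0 ≤ matK ((n - 1) * m + 1) n x y := by
      simp only [matK, Matrix.of_apply]
      split_ifs <;> norm_num
    have hJ : matJ (Fin ((n - 1) * m + 1) × Fin n) x y = 1 := rfl
    rw [Matrix.add_apply, Matrix.add_apply, hJ] at h
    linarith
  have fin01 : ∀ k l : ℕ, (k : ℝ) + l ≤ 1 → ((k : ℝ) = 0 ∨ (k : ℝ) = 1) := by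
    intro k l h
    have h' : k + l ≤ 1 := by exact_mod_cast h
    have : k = 0 ∨ k = 1 := by omega
    exact_mod_cast this
  refine ⟨?_, ?_, hsumall, ?_⟩
  · intro x y
    obtain ⟨k, hk⟩ := np x y
    obtain ⟨l, hl⟩ := nm x y
    have := hle x y
    rw [hk, hl] at this
    rw [hk]
    exact fin01 k l this
  · intro x y
    obtain ⟨k, hk⟩ := np x y
    obtain ⟨l, hl⟩ := nm x y
    have := hle x y
    rw [hk, hl, add_comm] at this
    rw [hl]
    exact fin01 l k this
  rw [hone, matK_eq, matJ_prod]
  exact ⟨p1, p2, q1, q2, p3, p4, q3, q4⟩
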